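/- (Stirling series via Bernoulli numbers) As s → +∞, log Γ(1+s) − s log(s/e) − (1/2)log(2πs) admits the asymptotic expansion Σ_{k≥1} (B_{2k}/(2k(2k−1))) s^{1−2k}; in particular, log Γ(1+s) = s log s − s + (1/2) log(2πs) + 1/(12s) + O(s^{-3}) as s → ∞ along the positive reals. -/

import Mathlib

open Filter Asymptotics

/-- The error in Stirling's approximation of `log Γ(1 + s)`. -/
noncomputable def logGammaStirlingError (s : ℝ) : ℝ :=
  Real.log (Real.Gamma (1 + s)) - (s * Real.log s - s + 1 / 2 * Real.log (2 * Real.pi * s))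

/-- The terms of Stirling's series, indexed by the exponent of `s⁻¹`. -/
noncomputable def stirlingTerm (j : ℕ) (s : ℝ) : ℝ :=
  (bernoulli (j + 1) : ℝ) / (j * (j + 1)) * (s ^ j)⁻¹

/-- The remainder integral `∫₀¹ B_m(x) (s + x)⁻ᵐ dx` in the Euler–Maclaurin formula. -/
noncomputable def bernoulliRemainder (m : ℕ) (s : ℝ) : ℝ :=
  ∫ x in (0 : ℝ)..1, bernoulliFun m x * ((s + x) ^ m)⁻¹

theorem bernoulliRemainder_one {s : ℝ} (hs : 0 < s) :
    bernoulliRemainder 1 s = 1 - (s + 1 / 2) * (Real.log (s + 1) - Real.log s) := by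
  have hpos : ∀ x ∈ Set.uIcc (0 : ℝ) 1, 0 < s + x := by
    intro x hx
    rw [Set.uIcc_of_le zero_le_one] at hx
    linarith [hx.1]
  have key := intervalIntegral.integral_eq_sub_of_hasDerivAt (a := (0 : ℝ)) (b := 1)
    (f := fun x => x - (s + 1 / 2) * Real.log (s + x))
    (f' := fun x => bernoulliFun 1 x * ((s + x) ^ 1)⁻¹) ?_ ?_
  · rw [bernoulliRemainder, key]
    simp only [add_zero]
    ring
  · intro x hx
    have h := hpos x hx
    have h1 : HasDerivAt (fun x => s + x) 1 x := (hasDerivAt_id x).const_add s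
    have h2 := (hasDerivAt_id x).sub ((h1.log h.ne').const_mul (s + 1 / 2))
    refine h2.congr_deriv ?_
    rw [bernoulliFun_one]
    field_simp
    ring
  · apply ContinuousOn.intervalIntegrable
    exact (continuous_bernoulliFun 1).continuousOn.mul
      (ContinuousOn.inv₀ (by fun_prop) fun x hx => (pow_pos (hpos x hx) _).ne')

theorem bernoulliRemainder_succ {m : ℕ} (hm : 1 ≤ m) {s : ℝ} (hs : 0 < s) :
    bernoulliRemainder m s / m =
      stirlingTerm m (s + 1) - stirlingTerm m s + bernoulliRemainder (m + 1) s / (m + 1) := by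
  have hpos : ∀ x ∈ Set.uIcc (0 : ℝ) 1, 0 < s + x := by
    intro x hx
    rw [Set.uIcc_of_le zero_le_one] at hx
    linarith [hx.1]
  have hm0 : (m : ℝ) ≠ 0 := by positivity
  have hm1 : (m : ℝ) + 1 ≠ 0 := by positivity
  have key := intervalIntegral.integral_mul_deriv_eq_deriv_mul (a := (0 : ℝ)) (b := 1)
    (u := fun x => ((s + x) ^ m)⁻¹) (u' := fun x => -(m * ((s + x) ^ (m + 1))⁻¹))
    (v := fun x => bernoulliFun (m + 1) x / (m + 1)) (v' := fun x => bernoulliFun m x)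
    ?_ ?_ ?_ ?_
  · have e1 : bernoulliRemainder m s = ∫ x in (0 : ℝ)..1, ((s + x) ^ m)⁻¹ * bernoulliFun m x := by
      simp only [bernoulliRemainder, mul_comm]
    have e2 : (∫ x in (0 : ℝ)..1, -(m * ((s + x) ^ (m + 1))⁻¹) *
        (bernoulliFun (m + 1) x / (m + 1))) = -(m / (m + 1)) * bernoulliRemainder (m + 1) s := by
      rw [bernoulliRemainder, ← intervalIntegral.integral_const_mul]
      congr 1
      ext x
      ring
    rw [e1, key, e2, bernoulliFun_endpoints_eq_of_ne_one (by omega), bernoulliFun_eval_zero]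
    simp only [stirlingTerm, add_zero]
    field_simp
    ring
  · intro x hx
    have h := hpos x hx
    have h1 : HasDerivAt (fun x => s + x) 1 x := (hasDerivAt_id x).const_add s
    convert (h1.fun_pow m).fun_inv (pow_pos h m).ne' using 1
    obtain ⟨k, rfl⟩ : ∃ k, m = k + 1 := ⟨m - 1, by omega⟩
    simp only [Nat.add_sub_cancel]
    field_simp
    ring
  · intro x _
    convert (hasDerivAt_bernoulliFun (m + 1) x).div_const ((m : ℝ) + 1) using 1
    simp only [Nat.add_sub_cancel]
    push_cast
    field_simp
  · apply ContinuousOn.intervalIntegrable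
    exact (continuousOn_const.mul
      (ContinuousOn.inv₀ (by fun_prop) fun x hx => (pow_pos (hpos x hx) _).ne')).neg
  · exact intervalIntegrable_bernoulliFun m 0 1

theorem bernoulliRemainder_one_eq {m : ℕ} (hm : 1 ≤ m) {s : ℝ} (hs : 0 < s) :
    bernoulliRemainder 1 s =
      ∑ j ∈ Finset.Ico 1 m, (stirlingTerm j (s + 1) - stirlingTerm j s) +
        bernoulliRemainder m s / m := by
  induction m, hm using Nat.le_induction with
  | base => simp
  | succ m hm ih =>
    rw [Finset.sum_Ico_succ_top hm, ih, bernoulliRemainder_succ hm hs]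
    push_cast
    ring

theorem exists_abs_bernoulliRemainder_le (m : ℕ) :
    ∃ C : ℝ, 0 ≤ C ∧ ∀ s : ℝ, 0 < s → |bernoulliRemainder m s| ≤ C * (s ^ m)⁻¹ := by
  obtain ⟨C, hC⟩ := (isCompact_Icc (a := (0 : ℝ)) (b := 1)).exists_bound_of_continuousOn
    (continuous_bernoulliFun m).continuousOn
  have hC0 : 0 ≤ C := (norm_nonneg _).trans (hC 0 (by simp))
  refine ⟨C, hC0, fun s hs => ?_⟩
  have key := intervalIntegral.norm_integral_le_of_norm_le_const (a := (0 : ℝ)) (b := 1)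
    (f := fun x => bernoulliFun m x * ((s + x) ^ m)⁻¹) (C := C * (s ^ m)⁻¹) ?_
  · simpa [bernoulliRemainder] using key
  · intro x hx
    rw [Set.uIoc_of_le zero_le_one] at hx
    have hx0 := hx.1
    rw [norm_mul, Real.norm_of_nonneg (r := ((s + x) ^ m)⁻¹) (by positivity)]
    gcongr
    · exact hC x ⟨hx.1.le, hx.2⟩
    · linarith

theorem logGammaStirlingError_sub_add_one {s : ℝ} (hs : 0 < s) :
    logGammaStirlingError s - logGammaStirlingError (s + 1) = -bernoulliRemainder 1 s := by
  have hg : Real.Gamma (1 + (s + 1)) = (1 + s) * Real.Gamma (1 + s) := by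
    rw [← add_assoc, Real.Gamma_add_one (by positivity)]
  have hG : Real.Gamma (1 + s) ≠ 0 := (Real.Gamma_pos_of_pos (by positivity)).ne'
  have hpi := Real.pi_pos
  rw [bernoulliRemainder_one hs, logGammaStirlingError, logGammaStirlingError, hg,
    Real.log_mul (by positivity) hG, Real.log_mul (by positivity) hs.ne',
    Real.log_mul (x := 2 * Real.pi) (y := s + 1) (by positivity) (by positivity), add_comm 1 s]
  ring

theorem tendsto_log_factorial_sub_stirling :
    Tendsto (fun n : ℕ => Real.log (n.factorial : ℝ) -
      (n * Real.log n - n + 1 / 2 * Real.log (2 * Real.pi * n))) atTop (nhds 0) := by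
  have hpi := Real.pi_pos
  have h := (Stirling.tendsto_stirlingSeq_sqrt_pi.log (by positivity)).sub_const
    (Real.log (√Real.pi))
  rw [sub_self] at h
  refine h.congr' ?_
  filter_upwards [eventually_gt_atTop 0] with n hn
  have hn' : (0 : ℝ) < n := by exact_mod_cast hn
  rw [Stirling.log_stirlingSeq_formula, Real.log_sqrt hpi.le, Real.log_div hn'.ne' (by positivity),
    Real.log_exp, Real.log_mul two_ne_zero hn'.ne', Real.log_mul (by positivity) hn'.ne',
    Real.log_mul two_ne_zero hpi.ne']
  ring

theorem tendsto_logGammaStirlingError_add_nat {s : ℝ} (hs : 0 < s) :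
    Tendsto (fun n : ℕ => logGammaStirlingError (s + n)) atTop (nhds 0) := by
  have hpi := Real.pi_pos
  have hfeq : ∀ {y : ℝ}, 0 < y →
      (Real.log ∘ Real.Gamma) (y + 1) = (Real.log ∘ Real.Gamma) y + Real.log y := by
    intro y hy
    simp only [Function.comp_apply]
    rw [Real.Gamma_add_one hy.ne', Real.log_mul hy.ne' (Real.Gamma_pos_of_pos hy).ne', add_comm]
  have h1 := (Real.BohrMollerup.tendsto_log_gamma hs).const_sub (Real.log (Real.Gamma s))
  have h2 := tendsto_log_factorial_sub_stirling
  have h3 : Tendsto (fun n : ℕ => (n : ℝ) * Real.log (1 + s / n)) atTop (nhds s) :=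
    (Real.tendsto_mul_log_one_add_div_atTop s).comp tendsto_natCast_atTop_atTop
  have h4 : Tendsto (fun n : ℕ => Real.log (1 + s / n)) atTop (nhds 0) := by
    have := ((tendsto_const_div_atTop_nhds_zero_nat s).const_add 1).log (by norm_num)
    simpa using this
  have h5 := ((h1.add h2).sub h3).add ((h4.const_mul (-(s + 1 / 2))).const_add s)
  have h6 : Real.log (Real.Gamma s) - Real.log (Real.Gamma s) + 0 - s +
      (s + -(s + 1 / 2) * 0) = 0 := by ring
  rw [h6] at h5
  refine h5.congr' ?_
  filter_upwards [eventually_gt_atTop 0] with n hn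
  have hn' : (0 : ℝ) < n := by exact_mod_cast hn
  have hG := Real.BohrMollerup.f_add_nat_eq (f := Real.log ∘ Real.Gamma) hfeq hs (n + 1)
  simp only [Function.comp_apply] at hG
  have e : 1 + (s + n) = s + ((n + 1 : ℕ) : ℝ) := by push_cast; ring
  have el : Real.log (1 + s / n) = Real.log (s + n) - Real.log n := by
    rw [← Real.log_div (by positivity) hn'.ne']
    congr 1
    field_simp
    ring
  rw [logGammaStirlingError, e, hG, Real.BohrMollerup.logGammaSeq, el,
    Real.log_mul (by positivity) hn'.ne',
    Real.log_mul (x := 2 * Real.pi) (y := s + n) (by positivity) (by positivity)]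
  ring

theorem tendsto_stirlingTerm_add_nat {j : ℕ} (hj : 1 ≤ j) (s : ℝ) :
    Tendsto (fun n : ℕ => stirlingTerm j (s + n)) atTop (nhds 0) := by
  have h1 : Tendsto (fun n : ℕ => s + (n : ℝ)) atTop atTop :=
    tendsto_atTop_add_const_left _ _ tendsto_natCast_atTop_atTop
  have h2 := ((tendsto_pow_atTop (α := ℝ) (n := j) (by omega)).comp h1).inv_tendsto_atTop
  simpa [stirlingTerm] using h2.const_mul ((bernoulli (j + 1) : ℝ) / (j * (j + 1)))

/-- A function vanishing at infinity along integer translates whose increments are `O(s⁻ᵖ⁻²)`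
is itself `O(s⁻ᵖ⁻¹)`. -/
theorem abs_le_of_abs_sub_add_one_le {h : ℝ → ℝ} {C : ℝ} {p : ℕ} (hC : 0 ≤ C)
    (hd : ∀ s, 0 < s → |h s - h (s + 1)| ≤ C * (s ^ (p + 2))⁻¹)
    {s : ℝ} (hs : 2 ≤ s) (hlim : Tendsto (fun n : ℕ => h (s + n)) atTop (nhds 0)) :
    |h s| ≤ 2 * C * (s ^ (p + 1))⁻¹ := by
  have hs0 : 0 < s := by linarith
  have step : ∀ n : ℕ, |h s| ≤
      |h (s + n)| + C * (s ^ p)⁻¹ * (1 / (s - 1) - 1 / (s + n - 1)) := by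
    intro n
    induction n with
    | zero => simp
    | succ n ih =>
      have hn : (0 : ℝ) ≤ n := n.cast_nonneg
      have hsn : 0 < s + n := by linarith
      have hsn1 : 0 < s + n - 1 := by linarith
      have h1 := hd (s + n) hsn
      have h2 : ((s + n) ^ (p + 2))⁻¹ ≤ (s ^ p)⁻¹ * (1 / (s + n - 1) - 1 / (s + n)) := by
        rw [pow_add, mul_inv]
        gcongr
        · linarith
        · rw [div_sub_div _ _ hsn1.ne' hsn.ne', inv_eq_one_div,
            div_le_div_iff₀ (by positivity) (by positivity)]
          nlinarith
      have h3 := mul_le_mul_of_nonneg_left h2 hC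
      have h4 : |h (s + n)| ≤ |h (s + n) - h (s + n + 1)| + |h (s + n + 1)| := by
        simpa using abs_add_le (h (s + n) - h (s + n + 1)) (h (s + n + 1))
      have e1 : s + ((n + 1 : ℕ) : ℝ) = s + n + 1 := by push_cast; ring
      rw [e1, add_sub_cancel_right]
      linarith
  have bound : ∀ n : ℕ, |h s| ≤ |h (s + n)| + 2 * C * (s ^ (p + 1))⁻¹ := by
    intro n
    refine (step n).trans ?_
    have hn : (0 : ℝ) ≤ n := n.cast_nonneg
    have h1 : 0 ≤ 1 / (s + n - 1) := one_div_nonneg.2 (by linarith)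
    have h2 : 1 / (s - 1) ≤ 2 * s⁻¹ := by
      rw [← div_eq_mul_inv, div_le_div_iff₀ (by linarith) hs0]
      linarith
    have h3 : C * (s ^ p)⁻¹ * (1 / (s - 1) - 1 / (s + n - 1)) ≤ C * (s ^ p)⁻¹ * (2 * s⁻¹) :=
      mul_le_mul_of_nonneg_left (by linarith) (by positivity)
    have h4 : C * (s ^ p)⁻¹ * (2 * s⁻¹) = 2 * C * (s ^ (p + 1))⁻¹ := by
      rw [pow_succ, mul_inv]
      ring
    linarith
  have hl := (hlim.abs).add_const (2 * C * (s ^ (p + 1))⁻¹)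
  rw [abs_zero, zero_add] at hl
  exact ge_of_tendsto' hl bound

theorem logGammaStirlingError_sub_sum_isBigO (p : ℕ) :
    (fun s : ℝ => logGammaStirlingError s - ∑ j ∈ Finset.Ico 1 (p + 2), stirlingTerm j s)
      =O[atTop] fun s : ℝ => (s ^ (p + 1))⁻¹ := by
  obtain ⟨C, hC, hb⟩ := exists_abs_bernoulliRemainder_le (p + 2)
  refine IsBigO.of_bound (2 * C) ?_
  filter_upwards [eventually_ge_atTop 2] with s hs
  have hs0 : 0 < s := by linarith
  rw [Real.norm_of_nonneg (r := (s ^ (p + 1))⁻¹) (by positivity), Real.norm_eq_abs]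
  refine abs_le_of_abs_sub_add_one_le (h := fun s => logGammaStirlingError s -
    ∑ j ∈ Finset.Ico 1 (p + 2), stirlingTerm j s) hC ?_ hs ?_
  · intro t ht
    have h1 := logGammaStirlingError_sub_add_one ht
    have h2 := bernoulliRemainder_one_eq (m := p + 2) (by omega) ht
    rw [Finset.sum_sub_distrib] at h2
    have h3 : logGammaStirlingError t - ∑ j ∈ Finset.Ico 1 (p + 2), stirlingTerm j t -
        (logGammaStirlingError (t + 1) - ∑ j ∈ Finset.Ico 1 (p + 2), stirlingTerm j (t + 1)) =
        -(bernoulliRemainder (p + 2) t / (p + 2 : ℕ)) := by linarith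
    rw [h3, abs_neg, abs_div, Nat.abs_cast]
    refine (div_le_self (abs_nonneg _) ?_).trans (hb t ht)
    exact_mod_cast (by omega : 1 ≤ p + 2)
  · have h1 := tendsto_finsetSum (Finset.Ico 1 (p + 2)) fun j hj =>
      tendsto_stirlingTerm_add_nat (Finset.mem_Ico.1 hj).1 s
    simpa using (tendsto_logGammaStirlingError_add_nat hs0).sub h1

theorem stirlingTerm_two_mul {k : ℕ} (hk : 1 ≤ k) (s : ℝ) : stirlingTerm (2 * k) s = 0 := by
  rw [stirlingTerm, bernoulli_eq_zero_of_odd ⟨k, rfl⟩ (by omega)]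
  simp

theorem stirlingTerm_two_mul_sub_one {k : ℕ} (hk : 1 ≤ k) (s : ℝ) :
    stirlingTerm (2 * k - 1) s =
      ((bernoulli (2 * k) : ℝ) / ((2 * (k : ℝ)) * (2 * (k : ℝ) - 1))) * s ^ (1 - 2 * (k : ℤ)) := by
  obtain ⟨l, rfl⟩ : ∃ l, k = l + 1 := ⟨k - 1, by omega⟩
  have e1 : 2 * (l + 1) - 1 = 2 * l + 1 := by omega
  have e2 : 1 - 2 * ((l + 1 : ℕ) : ℤ) = -((2 * l + 1 : ℕ) : ℤ) := by push_cast; ring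
  rw [e1, e2, zpow_neg, zpow_natCast, stirlingTerm, show 2 * l + 1 + 1 = 2 * (l + 1) by ring]
  congr 2
  push_cast
  ring

theorem sum_Ico_stirlingTerm {K : ℕ} (hK : 1 ≤ K) (s : ℝ) :
    ∑ j ∈ Finset.Ico 1 (2 * K), stirlingTerm j s =
      ∑ k ∈ Finset.Ico 1 (K + 1), stirlingTerm (2 * k - 1) s := by
  induction K, hK using Nat.le_induction with
  | base => simp
  | succ K hK ih =>
    rw [show 2 * (K + 1) = 2 * K + 1 + 1 by ring, Finset.sum_Ico_succ_top (by omega),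
      Finset.sum_Ico_succ_top (by omega), ih, Finset.sum_Ico_succ_top (b := K + 1) (by omega),
      stirlingTerm_two_mul hK, add_zero]
    rfl

theorem logGamma_sub_stirling_series_isBigO {K : ℕ} (hK : 1 ≤ K) :
    (fun s : ℝ => Real.log (Real.Gamma (1 + s)) -
        (s * Real.log (s / Real.exp 1) + (1 / 2) * Real.log (2 * Real.pi * s) +
          ∑ k ∈ Finset.Ico 1 K,
            ((bernoulli (2 * k) : ℝ) / ((2 * (k : ℝ)) * (2 * (k : ℝ) - 1))) *
              s ^ (1 - 2 * (k : ℤ))))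
      =O[atTop] fun s : ℝ => s ^ (1 - 2 * (K : ℤ)) := by
  obtain ⟨q, hq⟩ : ∃ q, 2 * K = q + 2 := ⟨2 * K - 2, by omega⟩
  have e : (fun s : ℝ => (s ^ (q + 1))⁻¹) = fun s : ℝ => s ^ (1 - 2 * (K : ℤ)) := by
    ext s
    rw [show 1 - 2 * (K : ℤ) = -((q + 1 : ℕ) : ℤ) by push_cast; omega, zpow_neg, zpow_natCast]
  have h1 := logGammaStirlingError_sub_sum_isBigO q
  rw [← hq, e] at h1
  have h2 : (fun s : ℝ => stirlingTerm (2 * K - 1) s) =O[atTop]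
      fun s : ℝ => s ^ (1 - 2 * (K : ℤ)) := by
    simp only [stirlingTerm_two_mul_sub_one hK]
    exact isBigO_const_mul_self _ _ _
  refine (h1.add h2).congr' ?_ EventuallyEq.rfl
  filter_upwards [eventually_gt_atTop 0] with s hs
  rw [sum_Ico_stirlingTerm hK, Finset.sum_Ico_succ_top hK, logGammaStirlingError,
    Real.log_div hs.ne' (Real.exp_pos 1).ne', Real.log_exp,
    Finset.sum_congr rfl fun k hk => stirlingTerm_two_mul_sub_one (Finset.mem_Ico.1 hk).1 s]
  ring

/-- Stirling's series via Bernoulli numbers: as `s → +∞`,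
`log Γ(1+s) - s log(s/e) - (1/2)log(2πs)` has the asymptotic expansion
`Σ_{k≥1} B_{2k}/(2k(2k-1)) s^{1-2k}` (each truncation with `k < K` has error
`O(s^{1-2K})`); in particular
`log Γ(1+s) = s log s - s + (1/2)log(2πs) + 1/(12s) + O(s⁻³)`. -/
theorem stirling_series_bernoulli :
    (∀ K : ℕ, 1 ≤ K →
      (fun s : ℝ => Real.log (Real.Gamma (1 + s)) -
          (s * Real.log (s / Real.exp 1) + (1 / 2) * Real.log (2 * Real.pi * s) +
            ∑ k ∈ Finset.Ico 1 K,
              ((bernoulli (2 * k) : ℝ) / ((2 * (k : ℝ)) * (2 * (k : ℝ) - 1))) *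
                s ^ (1 - 2 * (k : ℤ))))
        =O[atTop] fun s : ℝ => s ^ (1 - 2 * (K : ℤ))) ∧
    ((fun s : ℝ => Real.log (Real.Gamma (1 + s)) -
        (s * Real.log s - s + (1 / 2) * Real.log (2 * Real.pi * s) + 1 / (12 * s)))
      =O[atTop] fun s : ℝ => s ^ (-3 : ℤ)) := by
  refine ⟨fun K hK => logGamma_sub_stirling_series_isBigO hK, ?_⟩
  refine (logGamma_sub_stirling_series_isBigO one_le_two).congr' ?_ (by norm_num)
  filter_upwards [eventually_gt_atTop 0] with s hs
  rw [Real.log_div hs.ne' (Real.exp_pos 1).ne', Real.log_exp, show Finset.Ico 1 2 = {1} from rfl,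
    Finset.sum_singleton]
  norm_num [bernoulli_two, zpow_neg]
  ring
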